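/- A C*-algebra A has an abundance of soft elements if and only if it has an abundance of completely soft elements; that is: (for every a ∈ A₊ and every ε > 0 there exists a soft positive element b ∈ her(a) with (a−ε)₊ ◁ b) holds if and only if (for every a ∈ A₊ and every ε > 0 there exists a completely soft positive element b ∈ her(a) with (a−ε)₊ ◁ b). -/

import Mathlib

/-!
Common definitions: softness for (non-unital) C*-algebras.

A C*-algebra is *soft* if it has no nonzero unital quotient; equivalently, for every
closed two-sided ideal `I` with `A/I ≠ 0`, the quotient `A/I` is not unital.
We encode properties of the quotient `A/I` intrinsically in `A`.
-/

variable {A : Type*}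

/-- The quotient of `A` by the two-sided ideal `I` is unital: some `e ∈ A` represents
a multiplicative unit of `A/I`. -/
def QuotUnital [NonUnitalNonAssocRing A] (I : TwoSidedIdeal A) : Prop :=
  ∃ e : A, ∀ x : A, x * e - x ∈ I ∧ e * x - x ∈ I

/-- The quotient of `A` by the two-sided ideal `I` is nonzero. -/
def QuotNonzero [NonUnitalNonAssocRing A] (I : TwoSidedIdeal A) : Prop :=
  ∃ x : A, x ∉ I

/-- A C*-algebra is *soft* if it has no nonzero unital quotient. -/
def IsSoftCStar (A : Type*) [NonUnitalNonAssocRing A] [TopologicalSpace A] : Prop :=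
  ∀ I : TwoSidedIdeal A, IsClosed (I : Set A) → QuotNonzero I → ¬ QuotUnital I

/-- `a ◁ b` : `a` belongs to the closed two-sided ideal generated by `b`. -/
def Lhd [NonUnitalNonAssocRing A] [TopologicalSpace A] (a b : A) : Prop :=
  ∀ I : TwoSidedIdeal A, IsClosed (I : Set A) → b ∈ I → a ∈ I

/-- The hereditary subalgebra associated to `x`: the closed linear span of `x* A x`
(the set `{x* y x : y ∈ A}` is closed under multiplication, so the non-unital
subalgebra it generates is its linear span). -/
def her [NonUnitalCStarAlgebra A] (x : A) : NonUnitalSubalgebra ℂ A :=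
  (NonUnitalAlgebra.adjoin ℂ {z : A | ∃ y : A, z = star x * y * x}).topologicalClosure

/-- An element `x` of a C*-algebra is *soft* if its hereditary subalgebra
`her x = span(x* A x)‾` is a soft C*-algebra. -/
def IsSoftElem [NonUnitalCStarAlgebra A] (x : A) : Prop :=
  IsSoftCStar (her x)

/-- The cut-down `(a - ε)₊`, obtained by applying `t ↦ max (t - ε) 0` to `a` via the
(non-unital) continuous functional calculus. -/
noncomputable def cutDown [NonUnitalCStarAlgebra A] [PartialOrder A] [StarOrderedRing A]
    (a : A) (ε : ℝ) : A :=
  cfcₙ (fun t : ℝ => max (t - ε) 0) a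

/-- `a` is *completely soft* if `(a - ε)₊` is soft for every `ε ≥ 0`. -/
def CompletelySoftElem [NonUnitalCStarAlgebra A] [PartialOrder A] [StarOrderedRing A]
    (a : A) : Prop :=
  ∀ ε : ℝ, 0 ≤ ε → IsSoftElem (cutDown a ε)

open Filter Topology

section FunctionalCalculus

variable [NonUnitalCStarAlgebra A]

/-- The functional calculus respects intertwining relations. -/
lemma cfcₙ_mul_eq_mul_cfcₙ {a b y : A} (ha : IsSelfAdjoint a) (hb : IsSelfAdjoint b)
    (f : ℝ → ℝ) (hf : Continuous f) (h : a * y = y * b) :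
    cfcₙ f a * y = y * cfcₙ f b := by
  let S : NonUnitalStarSubalgebra ℝ (A × A) :=
    { carrier := {q | q.1 * y = y * q.2 ∧ star q.1 * y = y * star q.2}
      zero_mem' := by simp
      add_mem' := by
        rintro q q' ⟨h1, h2⟩ ⟨h3, h4⟩
        simp [add_mul, mul_add, *]
      mul_mem' := by
        rintro q q' ⟨h1, h2⟩ ⟨h3, h4⟩
        refine ⟨?_, ?_⟩
        · simp only [Prod.fst_mul, Prod.snd_mul]
          rw [mul_assoc, h3, ← mul_assoc, h1, mul_assoc]
        · simp only [Prod.fst_mul, Prod.snd_mul, star_mul]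
          rw [mul_assoc, h2, ← mul_assoc, h4, mul_assoc]
      smul_mem' := by
        rintro r q ⟨h1, h2⟩
        simp [smul_mul_assoc, mul_smul_comm, *]
      star_mem' := by
        rintro q ⟨h1, h2⟩
        simp [*] }
  have hS : IsClosed (S : Set (A × A)) := by
    apply IsClosed.inter
    · exact isClosed_eq (by fun_prop) (by fun_prop)
    · exact isClosed_eq (by fun_prop) (by fun_prop)
  have hab : (a, b) ∈ S := ⟨h, by simp [ha.star_eq, hb.star_eq, h]⟩
  have hsa : IsSelfAdjoint (a, b) := Prod.ext ha.star_eq hb.star_eq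
  have key : cfcₙ f (a, b) ∈ S := cfcₙ_mem (hs := hS) f hab
  rw [cfcₙ_map_prod (S := ℝ) f a b hf.continuousOn hsa ha hb] at key
  exact key.1

/-- The functional calculus on an eigenvector. -/
lemma cfcₙ_mul_eq_smul {a y : A} {r : ℝ} (ha : IsSelfAdjoint a)
    (f : ℝ → ℝ) (hf : Continuous f) (hf0 : f 0 = 0) (h : a * y = r • y) :
    cfcₙ f a * y = f r • y := by
  let S : NonUnitalStarSubalgebra ℝ (A × ℂ) :=
    { carrier := {q | q.1 * y = q.2 • y ∧ star q.1 * y = star q.2 • y}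
      zero_mem' := by simp
      add_mem' := by
        rintro q q' ⟨h1, h2⟩ ⟨h3, h4⟩
        simp only [Set.mem_ofPred_eq, Prod.fst_add, Prod.snd_add, star_add, add_mul, add_smul]
        exact ⟨by rw [h1, h3], by rw [h2, h4]⟩
      mul_mem' := by
        rintro q q' ⟨h1, h2⟩ ⟨h3, h4⟩
        refine ⟨?_, ?_⟩
        · simp only [Prod.fst_mul, Prod.snd_mul]
          rw [mul_assoc, h3, mul_smul_comm, h1, smul_smul, mul_comm]
        · simp only [Prod.fst_mul, Prod.snd_mul, star_mul]
          rw [mul_assoc, h2, mul_smul_comm, h4, smul_smul, mul_comm]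
      smul_mem' := by
        rintro s q ⟨h1, h2⟩
        simp only [Set.mem_ofPred_eq, Prod.smul_fst, Prod.smul_snd, star_smul, smul_mul_assoc, h1,
          h2, smul_assoc, star_trivial, and_self]
      star_mem' := by
        rintro q ⟨h1, h2⟩
        simp only [Set.mem_ofPred_eq, Prod.fst_star, Prod.snd_star, star_star]
        exact ⟨h2, h1⟩ }
  have hS : IsClosed (S : Set (A × ℂ)) := by
    apply IsClosed.inter
    · exact isClosed_eq (by fun_prop) (by fun_prop)
    · exact isClosed_eq (by fun_prop) (by fun_prop)
  have hr : IsSelfAdjoint (r : ℂ) := Complex.conj_ofReal r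
  have hab : (a, (r : ℂ)) ∈ S := by
    refine ⟨by simpa using h, ?_⟩
    simp only [ha.star_eq, hr.star_eq]
    simpa using h
  have hsa : IsSelfAdjoint (a, (r : ℂ)) := Prod.ext ha.star_eq hr.star_eq
  have key : cfcₙ f (a, (r : ℂ)) ∈ S := cfcₙ_mem (hs := hS) f hab
  rw [cfcₙ_map_prod (S := ℝ) f a (r : ℂ) hf.continuousOn hsa ha hr] at key
  have hc : cfcₙ f (r : ℂ) = (f r : ℂ) := by
    rw [cfcₙ_eq_cfc (hf := hf.continuousOn) (hf0 := hf0)]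
    exact cfc_algebraMap r f
  have := key.1
  rw [hc] at this
  simpa using this

variable [PartialOrder A] [StarOrderedRing A]

lemma cfcₙ_mul_cfcₙ_of_nonneg {a : A} (ha : 0 ≤ a) {f g h : ℝ → ℝ} (hf : Continuous f)
    (hf0 : f 0 = 0) (hg : Continuous g) (hg0 : g 0 = 0) (H : ∀ t, 0 ≤ t → f t * g t = h t) :
    cfcₙ f a * cfcₙ g a = cfcₙ h a := by
  rw [← cfcₙ_mul f g a hf.continuousOn hf0 hg.continuousOn hg0]
  exact cfcₙ_congr fun t ht => H t (quasispectrum_nonneg_of_nonneg a ha t ht)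

lemma cfcₙ_eq_self_of_nonneg {a : A} (ha : 0 ≤ a) {f : ℝ → ℝ} (H : ∀ t, 0 ≤ t → f t = t) :
    cfcₙ f a = a := by
  conv_rhs => rw [← cfcₙ_id' ℝ a]
  exact cfcₙ_congr fun t ht => H t (quasispectrum_nonneg_of_nonneg a ha t ht)

lemma cfcₙ_comp_of_nonneg {a : A} (ha : 0 ≤ a) {f g h : ℝ → ℝ} (hf : Continuous f)
    (hf0 : f 0 = 0) (hg : Continuous g) (hg0 : g 0 = 0) (H : ∀ t, 0 ≤ t → g (f t) = h t) :
    cfcₙ g (cfcₙ f a) = cfcₙ h a := by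
  rw [← cfcₙ_comp' g f a hg.continuousOn hg0 hf.continuousOn hf0]
  exact cfcₙ_congr fun t ht => H t (quasispectrum_nonneg_of_nonneg a ha t ht)

lemma norm_cfcₙ_le_of_nonneg {a : A} (ha : 0 ≤ a) {f : ℝ → ℝ} {C : ℝ}
    (H : ∀ t, 0 ≤ t → |f t| ≤ C) : ‖cfcₙ f a‖ ≤ C :=
  norm_cfcₙ_le fun t ht => H t (quasispectrum_nonneg_of_nonneg a ha t ht)

lemma cfcₙ_nonneg_of_nonneg {a : A} (ha : 0 ≤ a) {f : ℝ → ℝ}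
    (H : ∀ t, 0 ≤ t → 0 ≤ f t) : 0 ≤ cfcₙ f a :=
  cfcₙ_nonneg fun t ht => H t (quasispectrum_nonneg_of_nonneg a ha t ht)

lemma norm_self_sub_cfcₙ_le {a : A} (ha : 0 ≤ a) {f : ℝ → ℝ} (hf : Continuous f)
    (hf0 : f 0 = 0) {C : ℝ} (H : ∀ t, 0 ≤ t → |t - f t| ≤ C) : ‖a - cfcₙ f a‖ ≤ C := by
  have : a - cfcₙ f a = cfcₙ (fun t => t - f t) a := by
    rw [cfcₙ_sub (fun t => t) f a (by fun_prop) rfl hf.continuousOn hf0, cfcₙ_id' ℝ a]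
  rw [this]
  exact norm_cfcₙ_le_of_nonneg ha H

lemma cutDown_nonneg (a : A) (ε : ℝ) : 0 ≤ cutDown a ε :=
  cfcₙ_nonneg fun _ _ => le_max_right _ _

lemma cutDown_zero {a : A} (ha : 0 ≤ a) : cutDown a 0 = a :=
  cfcₙ_eq_self_of_nonneg ha fun t ht => by simp [ht]

lemma cutDown_cutDown {a : A} (ha : 0 ≤ a) {s t : ℝ} (hs : 0 ≤ s) (ht : 0 ≤ t) :
    cutDown (cutDown a s) t = cutDown a (s + t) := by
  refine cfcₙ_comp_of_nonneg ha (by fun_prop) (by simp [hs]) (by fun_prop) (by simp [ht])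
    fun u _ => ?_
  rcases le_total u s with h | h
  · rw [max_eq_right (by linarith : u - s ≤ 0), max_eq_right (by linarith),
      max_eq_right (by linarith)]
  · rw [max_eq_left (by linarith : 0 ≤ u - s), sub_sub]

lemma norm_sub_cutDown_le {a : A} (ha : 0 ≤ a) {s : ℝ} (hs : 0 ≤ s) : ‖a - cutDown a s‖ ≤ s := by
  refine norm_self_sub_cfcₙ_le ha (by fun_prop) (by simp [hs]) fun t ht => ?_
  rw [abs_le]
  rcases le_total t s with h | h
  · rw [max_eq_right (by linarith)]; constructor <;> linarith
  · rw [max_eq_left (by linarith)]; constructor <;> linarith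

/-- Approximate factorization of a positive element through itself. -/
lemma exists_norm_sub_mul_mul_lt {a : A} (ha : 0 ≤ a) {ε : ℝ} (hε : 0 < ε) :
    ∃ l : A, ‖a - l * a * a‖ < ε ∧ ‖a - a * l * a‖ < ε := by
  set f : ℝ → ℝ := fun t => t / (t ^ 2 + ε ^ 2) with hf
  have hpos : ∀ t : ℝ, 0 < t ^ 2 + ε ^ 2 := fun t => by positivity
  have hfc : Continuous f := by
    rw [hf]; exact Continuous.div (by fun_prop) (by fun_prop) fun t => (hpos t).ne'
  have hf0 : f 0 = 0 := by simp [hf]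
  set l := cfcₙ f a
  have hcomm : l * a = a * l := (Commute.cfcₙ_real (Commute.refl a) f).eq
  have h1 : l * a = cfcₙ (fun t => f t * t) a := by
    rw [cfcₙ_mul f (fun t => t) a hfc.continuousOn hf0, cfcₙ_id' ℝ a]
  have h2 : l * a * a = cfcₙ (fun t => f t * t * t) a := by
    rw [cfcₙ_mul (fun t => f t * t) (fun t => t) a (by fun_prop) (by simp), cfcₙ_id' ℝ a, h1]
  have h3 : ‖a - l * a * a‖ ≤ ε / 2 := by
    rw [h2]
    refine norm_self_sub_cfcₙ_le ha (by fun_prop) (by simp) fun t ht => ?_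
    have : t - f t * t * t = t * ε ^ 2 / (t ^ 2 + ε ^ 2) := by
      simp only [hf]; field_simp [(hpos t).ne']; ring
    rw [this, abs_of_nonneg (by positivity), div_le_iff₀ (hpos t)]
    nlinarith [mul_nonneg hε.le (sq_nonneg (t - ε))]
  exact ⟨l, by linarith, by rw [← hcomm]; linarith⟩

end FunctionalCalculus

section Ideals

lemma Lhd.refl [NonUnitalNonAssocRing A] [TopologicalSpace A] (a : A) : Lhd a a :=
  fun _ _ h => h

lemma Lhd.trans [NonUnitalNonAssocRing A] [TopologicalSpace A] {a b c : A} (h : Lhd a b)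
    (h' : Lhd b c) : Lhd a c :=
  fun I hI hc => h I hI (h' I hI hc)

/-- A point that can be approached geometrically from a closed set belongs to it. -/
lemma IsClosed.mem_of_forall_exists_norm_sub_le {B : Type*} [NormedAddCommGroup B] {s : Set B}
    (hs : IsClosed s) (hne : s.Nonempty) {z : B} {q : ℝ} (hq0 : 0 ≤ q) (hq : q < 1)
    (h : ∀ i ∈ s, ∃ j ∈ s, ‖z - j‖ ≤ q * ‖z - i‖) : z ∈ s := by
  rw [hs.mem_iff_infDist_zero hne]
  by_contra hd
  have hpos : 0 < Metric.infDist z s := lt_of_le_of_ne Metric.infDist_nonneg (Ne.symm hd)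
  set d := Metric.infDist z s
  have hM : d < 2 * d / (1 + q) := by
    rw [lt_div_iff₀ (by linarith)]; nlinarith
  obtain ⟨i, hi, hid⟩ := (Metric.infDist_lt_iff hne).1 hM
  obtain ⟨j, hj, hjd⟩ := h i hi
  have h1 : d ≤ ‖z - j‖ := by
    rw [← dist_eq_norm]; exact Metric.infDist_le_dist_of_mem hj
  rw [dist_eq_norm, lt_div_iff₀ (by linarith)] at hid
  nlinarith [norm_nonneg (z - i)]

variable [NonUnitalCStarAlgebra A] [PartialOrder A] [StarOrderedRing A]

lemma TwoSidedIdeal.real_smul_mem {I : TwoSidedIdeal A} (hI : IsClosed (I : Set A)) (r : ℝ)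
    {z : A} (hz : z ∈ I) : r • z ∈ I := by
  have hu := (CStarAlgebra.increasingApproximateUnit A).tendsto_mul_left z
  have hlim := hu.const_smul r
  refine hI.mem_of_tendsto hlim (Eventually.of_forall fun u => ?_)
  rw [← mul_smul_comm]
  exact I.mul_mem_right _ _ hz

lemma Lhd.real_smul {u e : A} (h : Lhd u e) (s : ℝ) : Lhd (s • u) e :=
  fun I hI he => I.real_smul_mem hI s (h I hI he)

lemma TwoSidedIdeal.cfcₙ_mem {I : TwoSidedIdeal A} (hI : IsClosed (I : Set A)) (f : ℝ → ℝ)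
    {a : A} (ha : IsSelfAdjoint a) (h : a ∈ I) : cfcₙ f a ∈ I := by
  let S : NonUnitalStarSubalgebra ℝ A :=
    { carrier := {z | z ∈ I ∧ star z ∈ I}
      zero_mem' := by simp [I.zero_mem]
      add_mem' := by
        rintro x y ⟨h1, h2⟩ ⟨h3, h4⟩
        exact ⟨I.add_mem h1 h3, by rw [star_add]; exact I.add_mem h2 h4⟩
      mul_mem' := by
        rintro x y ⟨h1, h2⟩ ⟨h3, h4⟩
        exact ⟨I.mul_mem_left _ _ h3, by rw [star_mul]; exact I.mul_mem_left _ _ h2⟩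
      smul_mem' := by
        rintro r x ⟨h1, h2⟩
        refine ⟨I.real_smul_mem hI r h1, ?_⟩
        rw [star_smul]
        exact I.real_smul_mem hI _ h2
      star_mem' := by
        rintro x ⟨h1, h2⟩
        exact ⟨h2, by rwa [star_star]⟩ }
  have hS : IsClosed (S : Set A) := hI.inter (hI.preimage continuous_star)
  have haS : a ∈ S := ⟨h, by rwa [ha.star_eq]⟩
  have key : cfcₙ f a ∈ S := _root_.cfcₙ_mem (hs := hS) f haS
  exact key.1

lemma lhd_cfcₙ {a : A} (ha : 0 ≤ a) (f : ℝ → ℝ) : Lhd (cfcₙ f a) a :=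
  fun I hI h => I.cfcₙ_mem hI f (IsSelfAdjoint.of_nonneg ha) h

lemma TwoSidedIdeal.mem_of_mul_self_mem {I : TwoSidedIdeal A} (hI : IsClosed (I : Set A))
    {a : A} (ha : 0 ≤ a) (h : a * a ∈ I) : a ∈ I := by
  have : a ∈ closure (I : Set A) := by
    rw [Metric.mem_closure_iff]
    intro ε hε
    obtain ⟨l, hl, -⟩ := exists_norm_sub_mul_mul_lt ha hε
    refine ⟨l * a * a, ?_, by rwa [dist_eq_norm]⟩
    rw [mul_assoc]
    exact I.mul_mem_left _ _ h
  rwa [hI.closure_eq] at this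

lemma TwoSidedIdeal.mem_of_mul_mul_self_mem {I : TwoSidedIdeal A} (hI : IsClosed (I : Set A))
    {a : A} (ha : 0 ≤ a) (h : a * a * a ∈ I) : a ∈ I := by
  refine I.mem_of_mul_self_mem hI ha ?_
  have : a * a ∈ closure (I : Set A) := by
    rw [Metric.mem_closure_iff]
    intro ε hε
    have hpos : 0 < ‖a‖ + 1 := by positivity
    obtain ⟨l, hl, -⟩ := exists_norm_sub_mul_mul_lt ha (div_pos hε hpos)
    refine ⟨l * (a * a * a), I.mul_mem_left _ _ h, ?_⟩
    rw [dist_eq_norm]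
    calc ‖a * a - l * (a * a * a)‖ = ‖(a - l * a * a) * a‖ := by
          simp only [sub_mul, mul_assoc]
      _ ≤ ‖a - l * a * a‖ * ‖a‖ := norm_mul_le _ _
      _ ≤ ε / (‖a‖ + 1) * ‖a‖ := by gcongr
      _ < ε := by
          rw [div_mul_eq_mul_div, div_lt_iff₀ hpos]
          nlinarith
  rwa [hI.closure_eq] at this

/-- If `a` is within `r` of a closed ideal, then the ideal contains `(a - r')₊` for `r' > r`. -/
lemma TwoSidedIdeal.cutDown_mem_of_norm_sub_le {I : TwoSidedIdeal A} (hI : IsClosed (I : Set A))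
    {a v : A} (ha : 0 ≤ a) (hv : v ∈ I) {r r' : ℝ} (hr : 0 ≤ r) (hrr' : r < r')
    (h : ‖a - v‖ ≤ r) : cutDown a r' ∈ I := by
  have hr' : 0 < r' := hr.trans_lt hrr'
  have hmax : ∀ t : ℝ, 0 < max t r' := fun t => lt_max_of_lt_right hr'
  set k : ℝ → ℝ := fun t => t / max t r' ^ 2 with hk
  have hkc : Continuous k := Continuous.div (by fun_prop) (by fun_prop) fun t =>
    (pow_pos (hmax t) 2).ne'
  have hk0 : k 0 = 0 := by simp [hk]
  set K := cfcₙ k a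
  have hK : ‖K‖ ≤ 1 / r' := by
    refine norm_cfcₙ_le_of_nonneg ha fun t ht => ?_
    rw [abs_of_nonneg (div_nonneg ht (by positivity)), div_le_div_iff₀ (pow_pos (hmax t) 2) hr']
    have h1 : t ≤ max t r' := le_max_left _ _
    have h2 : r' ≤ max t r' := le_max_right _ _
    nlinarith
  set z := cutDown a r'
  have hz : a * K * z = z := by
    have h1 : a * K = cfcₙ (fun t => t * k t) a := by
      rw [cfcₙ_mul (fun t => t) k a (by fun_prop) rfl hkc.continuousOn hk0, cfcₙ_id' ℝ a]
    rw [h1]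
    refine cfcₙ_mul_cfcₙ_of_nonneg ha (by fun_prop) (by simp) (by fun_prop) (by simp [hr'.le])
      fun t _ => ?_
    rcases le_total t r' with ht | ht
    · rw [max_eq_right (by linarith : t - r' ≤ 0), mul_zero]
    · have : t ≠ 0 := by linarith
      simp only [hk, max_eq_left ht]
      field_simp
  refine hI.mem_of_forall_exists_norm_sub_le ⟨0, I.zero_mem⟩ (q := r / r') (by positivity)
    ((div_lt_one hr').2 hrr') fun i hi => ?_
  refine ⟨v * K * z + (a - v) * K * i, I.add_mem ?_ ?_, ?_⟩
  · exact I.mul_mem_right _ _ (I.mul_mem_right _ _ hv)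
  · exact I.mul_mem_left _ _ hi
  · have : z - (v * K * z + (a - v) * K * i) = (a - v) * K * (z - i) := by
      rw [mul_sub, sub_mul a v K, sub_mul _ _ z, hz]
      abel
    rw [this]
    calc ‖(a - v) * K * (z - i)‖ ≤ ‖a - v‖ * ‖K‖ * ‖z - i‖ :=
          (norm_mul_le _ _).trans (by gcongr; exact norm_mul_le _ _)
      _ ≤ r * (1 / r') * ‖z - i‖ := by gcongr
      _ = r / r' * ‖z - i‖ := by ring

lemma lhd_cutDown_of_le {y : A} (hy : 0 ≤ y) {s t : ℝ} (hs : 0 ≤ s) (hst : s ≤ t) :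
    Lhd (cutDown y t) (cutDown y s) := by
  have := cutDown_cutDown hy hs (sub_nonneg.2 hst)
  rw [add_sub_cancel] at this
  rw [← this]
  exact lhd_cfcₙ (cutDown_nonneg y s) _

/-- Compactness of the relation `◁`. -/
lemma Lhd.exists_cutDown {x y : A} (hx : 0 ≤ x) (hy : 0 ≤ y) (h : Lhd x y) {ε : ℝ}
    (hε : 0 < ε) : ∃ η : ℝ, 0 < η ∧ Lhd (cutDown x ε) (cutDown y η) := by
  let P : Set A := {x | ∀ ε > 0, ∃ η : ℝ, 0 < η ∧ ∃ v, ‖x - v‖ < ε ∧ Lhd v (cutDown y η)}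
  let J : TwoSidedIdeal A := TwoSidedIdeal.mk' P
    (fun ε hε => ⟨1, one_pos, 0, by simpa using hε, fun I _ _ => I.zero_mem⟩)
    (by
      intro a b ha hb ε hε
      obtain ⟨η, hη, v, hv, hvy⟩ := ha (ε / 2) (by linarith)
      obtain ⟨θ, hθ, w, hw, hwy⟩ := hb (ε / 2) (by linarith)
      refine ⟨min η θ, lt_min hη hθ, v + w, ?_, fun I hI h => I.add_mem ?_ ?_⟩
      · rw [add_sub_add_comm]
        exact (norm_add_le _ _).trans_lt (by linarith)
      · exact (hvy.trans (lhd_cutDown_of_le hy (lt_min hη hθ).le (min_le_left _ _))) I hI h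
      · exact (hwy.trans (lhd_cutDown_of_le hy (lt_min hη hθ).le (min_le_right _ _))) I hI h)
    (by
      intro a ha ε hε
      obtain ⟨η, hη, v, hv, hvy⟩ := ha ε hε
      refine ⟨η, hη, -v, ?_, fun I hI h => I.neg_mem (hvy I hI h)⟩
      rwa [← neg_sub_neg, neg_neg, neg_neg, norm_sub_rev] )
    (by
      intro a b hb ε hε
      obtain ⟨η, hη, v, hv, hvy⟩ := hb (ε / (‖a‖ + 1)) (by positivity)
      refine ⟨η, hη, a * v, ?_, fun I hI h => I.mul_mem_left _ _ (hvy I hI h)⟩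
      rw [← mul_sub]
      rw [lt_div_iff₀ (by positivity)] at hv
      refine (norm_mul_le _ _).trans_lt ?_
      nlinarith [norm_nonneg (b - v), norm_nonneg a])
    (by
      intro b a hb ε hε
      obtain ⟨η, hη, v, hv, hvy⟩ := hb (ε / (‖a‖ + 1)) (by positivity)
      refine ⟨η, hη, v * a, ?_, fun I hI h => I.mul_mem_right _ _ (hvy I hI h)⟩
      rw [← sub_mul]
      rw [lt_div_iff₀ (by positivity)] at hv
      refine (norm_mul_le _ _).trans_lt ?_
      nlinarith [norm_nonneg (b - v), norm_nonneg a])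
  have hJP : (J : Set A) = P := TwoSidedIdeal.coe_mk' ..
  have hJ : IsClosed (J : Set A) := by
    rw [hJP]
    refine isClosed_of_closure_subset fun x hx ε hε => ?_
    obtain ⟨x', hx', hd⟩ := Metric.mem_closure_iff.1 hx (ε / 2) (by linarith)
    obtain ⟨η, hη, v, hv, hvy⟩ := hx' (ε / 2) (by linarith)
    refine ⟨η, hη, v, ?_, hvy⟩
    rw [dist_eq_norm] at hd
    exact (norm_sub_le_norm_sub_add_norm_sub x x' v).trans_lt (by linarith)
  have hyJ : y ∈ (J : Set A) := by
    rw [hJP]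
    exact fun ε hε => ⟨ε / 2, by linarith, cutDown y (ε / 2),
      (norm_sub_cutDown_le hy (by linarith)).trans_lt (by linarith), Lhd.refl _⟩
  have hxJ : x ∈ (J : Set A) := h J hJ hyJ
  rw [hJP] at hxJ
  obtain ⟨η, hη, v, hv, hvy⟩ := hxJ (ε / 2) (by linarith)
  exact ⟨η, hη, fun I hI hyI => I.cutDown_mem_of_norm_sub_le hI hx (hvy I hI hyI) (by linarith)
    (by linarith : ε / 2 < ε) hv.le⟩

end Ideals

section Hereditary

variable [NonUnitalCStarAlgebra A]

lemma isClosed_her (x : A) : IsClosed (her x : Set A) :=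
  NonUnitalSubalgebra.isClosed_topologicalClosure _

lemma mul_mul_mem_her {x : A} (hx : IsSelfAdjoint x) (y : A) : x * y * x ∈ her x :=
  NonUnitalSubalgebra.le_topologicalClosure _
    (NonUnitalAlgebra.subset_adjoin ℂ ⟨y, by rw [hx.star_eq]⟩)

lemma coe_her {x : A} (hx : IsSelfAdjoint x) :
    (her x : Set A) = closure {z | ∃ y, z = x * y * x} := by
  let S : NonUnitalSubalgebra ℂ A :=
    { carrier := {z | ∃ y, z = x * y * x}
      zero_mem' := ⟨0, by simp⟩
      add_mem' := by
        rintro _ _ ⟨y, rfl⟩ ⟨z, rfl⟩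
        exact ⟨y + z, by rw [mul_add, add_mul]⟩
      mul_mem' := by
        rintro _ _ ⟨y, rfl⟩ ⟨z, rfl⟩
        exact ⟨y * x * x * z, by simp only [mul_assoc]⟩
      smul_mem' := by
        rintro r _ ⟨y, rfl⟩
        exact ⟨r • y, by rw [mul_smul_comm, smul_mul_assoc]⟩ }
  refine subset_antisymm ?_ (closure_minimal ?_ (isClosed_her x))
  · change closure (NonUnitalAlgebra.adjoin ℂ {z : A | ∃ y : A, z = star x * y * x} : Set A) ⊆ _
    refine closure_mono ?_
    have : NonUnitalAlgebra.adjoin ℂ {z : A | ∃ y : A, z = star x * y * x} ≤ S :=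
      NonUnitalAlgebra.adjoin_le fun z ⟨y, hy⟩ => ⟨y, by rw [hy, hx.star_eq]⟩
    exact this
  · rintro _ ⟨y, rfl⟩
    exact mul_mul_mem_her hx y

lemma her_induction {x : A} (hx : IsSelfAdjoint x) {P : A → Prop} (hP : IsClosed {z | P z})
    (h : ∀ y, P (x * y * x)) {z : A} (hz : z ∈ her x) : P z := by
  have hz' : z ∈ closure {z | ∃ y, z = x * y * x} := coe_her hx ▸ hz
  refine closure_minimal (t := {z | P z}) ?_ hP hz'
  rintro _ ⟨y, rfl⟩
  exact h y

lemma mul_mul_mem_her_of_mem {x u v : A} (hx : IsSelfAdjoint x) (hu : u ∈ her x)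
    (hv : v ∈ her x) (z : A) : u * z * v ∈ her x := by
  refine her_induction hx (P := fun u => u * z * v ∈ her x)
    ((isClosed_her x).preimage (by fun_prop)) (fun y => ?_) hu
  refine her_induction hx (P := fun v => x * y * x * z * v ∈ her x)
    ((isClosed_her x).preimage (by fun_prop)) (fun y' => ?_) hv
  have : x * y * x * z * (x * y' * x) = x * (y * x * z * x * y') * x := by
    simp only [mul_assoc]
  rw [this]
  exact mul_mul_mem_her hx _

variable [PartialOrder A] [StarOrderedRing A]

lemma mem_her_self {x : A} (hx : 0 ≤ x) : x ∈ her x := by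
  have hsa := IsSelfAdjoint.of_nonneg hx
  have : x ∈ (her x : Set A) := by
    rw [coe_her hsa, Metric.mem_closure_iff]
    intro ε hε
    obtain ⟨l, -, hl⟩ := exists_norm_sub_mul_mul_lt hx hε
    exact ⟨_, ⟨l, rfl⟩, by rwa [dist_eq_norm]⟩
  exact this

lemma cfcₙ_mem_her {x c : A} (hx : 0 ≤ x) (hc : IsSelfAdjoint c) (h : c ∈ her x) (f : ℝ → ℝ) :
    cfcₙ f c ∈ her x := by
  have hsa := IsSelfAdjoint.of_nonneg hx
  let S : NonUnitalStarSubalgebra ℝ A :=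
    { carrier := {z | z ∈ her x ∧ star z ∈ her x}
      zero_mem' := by simp
      add_mem' := by
        rintro x y ⟨h1, h2⟩ ⟨h3, h4⟩
        exact ⟨add_mem h1 h3, by rw [star_add]; exact add_mem h2 h4⟩
      mul_mem' := by
        rintro x y ⟨h1, h2⟩ ⟨h3, h4⟩
        exact ⟨mul_mem h1 h3, by rw [star_mul]; exact mul_mem h4 h2⟩
      smul_mem' := by
        rintro r x ⟨h1, h2⟩
        refine ⟨?_, ?_⟩
        · have := (her _).smul_mem (r : ℂ) h1
          simpa using this
        · have := (her _).smul_mem (r : ℂ) h2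
          rw [star_smul]
          simpa using this
      star_mem' := by
        rintro x ⟨h1, h2⟩
        exact ⟨h2, by rwa [star_star]⟩ }
  have hS : IsClosed (S : Set A) :=
    (isClosed_her x).inter ((isClosed_her x).preimage continuous_star)
  have hcS : c ∈ S := ⟨h, by rwa [hc.star_eq]⟩
  have key : cfcₙ f c ∈ S := cfcₙ_mem (hs := hS) f hcS
  exact key.1

end Hereditary

section SoftCriterion

/-- The piecewise linear function interpolating between `0` at `0` and `1` on `[δ, ∞)`. -/
noncomputable def ramp (δ t : ℝ) : ℝ := min (t / δ) 1

/-- A function that is positive exactly on the interval `(0, δ)` of the positive half-line. -/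
noncomputable def softBump (δ t : ℝ) : ℝ := ramp δ t - ramp δ t * ramp δ t

@[fun_prop]
lemma continuous_ramp (δ : ℝ) : Continuous (ramp δ) := by unfold ramp; fun_prop

@[fun_prop]
lemma continuous_softBump (δ : ℝ) : Continuous (softBump δ) := by unfold softBump; fun_prop

@[simp]
lemma ramp_zero (δ : ℝ) : ramp δ 0 = 0 := by simp [ramp]

@[simp]
lemma softBump_zero (δ : ℝ) : softBump δ 0 = 0 := by simp [softBump]

lemma ramp_of_le {δ t : ℝ} (hδ : 0 < δ) (h : δ ≤ t) : ramp δ t = 1 :=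
  min_eq_right ((one_le_div hδ).2 h)

lemma ramp_of_ge {δ t : ℝ} (hδ : 0 < δ) (h : t ≤ δ) : ramp δ t = t / δ :=
  min_eq_left ((div_le_one hδ).2 h)

lemma ramp_nonneg {δ t : ℝ} (hδ : 0 < δ) (ht : 0 ≤ t) : 0 ≤ ramp δ t :=
  le_min (by positivity) zero_le_one

lemma ramp_le_one (δ t : ℝ) : ramp δ t ≤ 1 := min_le_right _ _

lemma softBump_of_le {δ t : ℝ} (hδ : 0 < δ) (h : δ ≤ t) : softBump δ t = 0 := by
  simp [softBump, ramp_of_le hδ h]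

lemma softBump_pos {δ t : ℝ} (ht : 0 < t) (h : t < δ) : 0 < softBump δ t := by
  have hδ := ht.trans h
  have h1 : t / δ < 1 := (div_lt_one hδ).2 h
  have h2 : 0 < t / δ := by positivity
  rw [softBump, ramp_of_ge hδ h.le]
  nlinarith

lemma softBump_nonneg {δ t : ℝ} (hδ : 0 < δ) (ht : 0 ≤ t) : 0 ≤ softBump δ t := by
  have := ramp_nonneg hδ ht
  have := ramp_le_one δ t
  rw [softBump]
  nlinarith

lemma cfcₙ_softBump_eq [NonUnitalCStarAlgebra A] (c : A) (δ : ℝ) :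
    cfcₙ (softBump δ) c = cfcₙ (ramp δ) c - cfcₙ (ramp δ) c * cfcₙ (ramp δ) c := by
  have : softBump δ = fun t => ramp δ t - ramp δ t * ramp δ t := rfl
  rw [this, cfcₙ_sub (ramp δ) (fun t => ramp δ t * ramp δ t) c, cfcₙ_mul (ramp δ) (ramp δ) c]
   

variable [NonUnitalCStarAlgebra A] [PartialOrder A] [StarOrderedRing A]

/-- A positive element is `SoftPos` if it lies in the closed ideal generated by its spectral
part in any interval `(0, δ)`. -/
def SoftPos (c : A) : Prop :=
  0 ≤ c ∧ ∀ δ : ℝ, 0 < δ → Lhd c (cfcₙ (softBump δ) c)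

lemma smul_cfcₙ_softBump {c : A} (hc : 0 ≤ c) {δ : ℝ} (hδ : 0 < δ) :
    δ • cfcₙ (softBump δ) c = c - c * cfcₙ (ramp δ) c := by
  have h1 : c * cfcₙ (ramp δ) c = cfcₙ (fun t => t * ramp δ t) c := by
    rw [cfcₙ_mul (fun t => t) (ramp δ) c, cfcₙ_id' ℝ c]
  have h2 : c - cfcₙ (fun t => t * ramp δ t) c = cfcₙ (fun t => t - t * ramp δ t) c := by
    rw [cfcₙ_sub (fun t => t) (fun t => t * ramp δ t) c, cfcₙ_id' ℝ c]
  rw [h1, h2, ← cfcₙ_smul δ (softBump δ) c (by fun_prop) (by simp)]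
  refine cfcₙ_congr fun t ht => ?_
  rcases le_total t δ with h | h
  · simp only [softBump, ramp_of_ge hδ h, smul_eq_mul]
    field_simp
  · simp [softBump, ramp_of_le hδ h]

lemma softPos_of_isSoftElem {c : A} (hc : 0 ≤ c) (h : IsSoftElem c) : SoftPos c := by
  refine ⟨hc, fun δ hδ I hI hp => ?_⟩
  have hsa := IsSelfAdjoint.of_nonneg hc
  let J : TwoSidedIdeal (her c) := I.comap (NonUnitalSubalgebraClass.subtype (her c))
  have hJmem : ∀ z : her c, z ∈ J ↔ (z : A) ∈ I := fun z => TwoSidedIdeal.mem_comap _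
  have hJ : IsClosed (J : Set (her c)) := by
    have : (J : Set (her c)) = Subtype.val ⁻¹' (I : Set A) := Set.ext hJmem
    rw [this]
    exact hI.preimage continuous_subtype_val
  set e := cfcₙ (ramp δ) c with he
  have heh : e ∈ her c := cfcₙ_mem_her hc hsa (mem_her_self hc) _
  have hcomm : e * c = c * e := (Commute.cfcₙ_real (Commute.refl c) _).eq
  have hcI : c - c * e ∈ I := by
    rw [he, ← smul_cfcₙ_softBump hc hδ]
    exact I.real_smul_mem hI δ hp
  have hcI' : c * e - c ∈ I := by
    rw [← neg_sub]; exact I.neg_mem hcI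
  have hunit : QuotUnital J := by
    refine ⟨⟨e, heh⟩, fun z => ⟨?_, ?_⟩⟩
    · rw [hJmem]
      refine her_induction hsa (P := fun z => z * e - z ∈ I)
        (hI.preimage (by fun_prop)) (fun y => ?_) z.2
      rw [mul_assoc, ← mul_sub]
      exact I.mul_mem_left _ _ hcI'
    · rw [hJmem]
      refine her_induction hsa (P := fun z => e * z - z ∈ I)
        (hI.preimage (by fun_prop)) (fun y => ?_) z.2
      rw [mul_assoc, ← mul_assoc, ← sub_mul, hcomm]
      exact I.mul_mem_right _ _ hcI'
  by_contra hcn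
  exact h J hJ ⟨⟨c, mem_her_self hc⟩, fun hh => hcn ((hJmem _).1 hh)⟩ hunit

lemma SoftPos.isSoftElem {x : A} (h : SoftPos x) : IsSoftElem x := by
  obtain ⟨hx, hsoft⟩ := h
  have hsa := IsSelfAdjoint.of_nonneg hx
  rintro J hJ ⟨x', hx'⟩ ⟨e, he⟩
  set J' : Set A := Subtype.val '' (J : Set (her x)) with hJ'
  have hJ'c : IsClosed J' := (isClosed_her x).isClosedEmbedding_subtypeVal.isClosedMap _ hJ
  have zero_memJ : (0 : A) ∈ J' := ⟨0, J.zero_mem, rfl⟩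
  have add_memJ : ∀ u v, u ∈ J' → v ∈ J' → u + v ∈ J' := by
    rintro _ _ ⟨u, hu, rfl⟩ ⟨v, hv, rfl⟩
    exact ⟨u + v, J.add_mem hu hv, rfl⟩
  have neg_memJ : ∀ u, u ∈ J' → -u ∈ J' := by
    rintro _ ⟨u, hu, rfl⟩
    exact ⟨-u, J.neg_mem hu, rfl⟩
  have mul_left_memJ : ∀ u v, u ∈ her x → v ∈ J' → u * v ∈ J' := by
    rintro u _ hu ⟨v, hv, rfl⟩
    exact ⟨⟨u, hu⟩ * v, J.mul_mem_left _ _ hv, rfl⟩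
  have mul_right_memJ : ∀ u v, u ∈ J' → v ∈ her x → u * v ∈ J' := by
    rintro _ v ⟨u, hu, rfl⟩ hv
    exact ⟨u * ⟨v, hv⟩, J.mul_mem_right _ _ hu, rfl⟩
  have hxh := mem_her_self hx
  obtain ⟨y, hy⟩ : ∃ y, ‖(e : A) - x * y * x‖ < 1 / 4 := by
    have : (e : A) ∈ closure {z | ∃ y, z = x * y * x} := coe_her hsa ▸ e.2
    obtain ⟨_, ⟨y, rfl⟩, hy⟩ := Metric.mem_closure_iff.1 this (1 / 4) (by norm_num)
    exact ⟨y, by rwa [dist_eq_norm] at hy⟩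
  set δ : ℝ := 1 / (4 * (‖x * y‖ + 1)) with hδ
  have hδ0 : 0 < δ := by positivity
  set v := x * y * cutDown x δ with hv
  have hvh : v ∈ her x :=
    mul_mul_mem_her_of_mem hsa hxh (cfcₙ_mem_her hx hsa hxh _) y
  have hev : ‖(e : A) - v‖ ≤ 1 / 2 := by
    have h1 : ‖x * y * x - v‖ ≤ 1 / 4 := by
      rw [hv, ← mul_sub]
      refine (norm_mul_le _ _).trans ((mul_le_mul_of_nonneg_left
        (norm_sub_cutDown_le hx hδ0.le) (norm_nonneg _)).trans ?_)
      rw [hδ, mul_one_div, div_le_div_iff₀ (by positivity) (by norm_num)]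
      linarith
    exact (norm_sub_le_norm_sub_add_norm_sub _ (x * y * x) _).trans (by linarith)
  set p := cfcₙ (softBump δ) x with hp
  have hp0 : 0 ≤ p := cfcₙ_nonneg_of_nonneg hx fun t ht => softBump_nonneg hδ0 ht
  have hph : p ∈ her x := cfcₙ_mem_her hx hsa hxh _
  have hvp : v * p = 0 := by
    have : cutDown x δ * p = 0 := by
      rw [cutDown, hp, cfcₙ_mul_cfcₙ_of_nonneg hx (h := fun _ => 0) (by fun_prop)
        (by simp [hδ0.le]) (by fun_prop) (by simp) fun t ht => ?_]
      · exact cfcₙ_zero ..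
      · rcases le_total t δ with h | h
        · rw [max_eq_right (by linarith), zero_mul]
        · rw [softBump_of_le hδ0 h, mul_zero]
    rw [hv, mul_assoc, this, mul_zero]
  have hepJ : p - e * p ∈ J' := by
    rw [← neg_sub]
    exact neg_memJ _ ⟨_, (he ⟨p, hph⟩).2, rfl⟩
  have hpJ : p ∈ J' := by
    refine hJ'c.mem_of_forall_exists_norm_sub_le ⟨0, zero_memJ⟩ (q := 1 / 2) (by norm_num)
      (by norm_num) fun i hi => ?_
    refine ⟨(e - v) * i + (p - e * p), add_memJ _ _ ?_ hepJ, ?_⟩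
    · exact mul_left_memJ _ _ (sub_mem e.2 hvh) hi
    · have : p - ((e - v) * i + (p - e * p)) = (e - v) * (p - i) := by
        rw [mul_sub, sub_mul _ v p, hvp]; abel
      rw [this]
      exact (norm_mul_le _ _).trans (by gcongr)
  let K : TwoSidedIdeal A := TwoSidedIdeal.mk' {z | ∀ a b, x * a * z * b * x ∈ J'}
    (fun a b => by simpa using zero_memJ)
    (by
      intro z w hz hw a b
      rw [mul_add, add_mul, add_mul]
      exact add_memJ _ _ (hz a b) (hw a b))
    (by
      intro z hz a b
      rw [mul_neg, neg_mul, neg_mul]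
      exact neg_memJ _ (hz a b))
    (by
      intro z w hw a b
      have := hw (a * z) b
      simpa only [mul_assoc] using this)
    (by
      intro z w hz a b
      have := hz a (w * b)
      simpa only [mul_assoc] using this)
  have hKmem : ∀ z, z ∈ K ↔ ∀ a b, x * a * z * b * x ∈ J' := fun z => by
    rw [← SetLike.mem_coe, TwoSidedIdeal.coe_mk']; rfl
  have hK : IsClosed (K : Set A) := by
    have : (K : Set A) = ⋂ a, ⋂ b, (fun z => x * a * z * b * x) ⁻¹' J' := by
      ext z
      simp only [SetLike.mem_coe, hKmem, Set.mem_iInter, Set.mem_preimage]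
    rw [this]
    exact isClosed_iInter fun a => isClosed_iInter fun b => hJ'c.preimage (by fun_prop)
  have hpK : p ∈ K := by
    refine K.mem_of_mul_mul_self_mem hK hp0 ((hKmem _).2 fun a b => ?_)
    have : x * a * (p * p * p) * b * x = (x * a * p) * p * (p * b * x) := by
      simp only [mul_assoc]
    rw [this]
    exact mul_right_memJ _ _ (mul_left_memJ _ _ (mul_mul_mem_her_of_mem hsa hxh hph a) hpJ)
      (mul_mul_mem_her_of_mem hsa hph hxh b)
  have hxK := (hKmem x).1 (hsoft δ hδ0 K hK hpK)
  have hall : ∀ y, x * y * x ∈ J' := by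
    intro y
    rw [← hJ'c.closure_eq, Metric.mem_closure_iff]
    intro ε hε
    obtain ⟨l, -, hl⟩ := exists_norm_sub_mul_mul_lt hx
      (ε := ε / (‖y * x‖ + 1)) (by positivity)
    refine ⟨_, hxK l y, ?_⟩
    have : x * y * x - x * l * x * y * x = (x - x * l * x) * (y * x) := by
      simp only [sub_mul, mul_assoc]
    rw [dist_eq_norm, this]
    rw [lt_div_iff₀ (by positivity)] at hl
    refine (norm_mul_le _ _).trans_lt ?_
    nlinarith [norm_nonneg (x - x * l * x), norm_nonneg (y * x)]
  obtain ⟨w, hw, hwx⟩ := her_induction hsa (P := fun z => z ∈ J') hJ'c hall x'.2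
  exact hx' (Subtype.ext hwx ▸ hw)

end SoftCriterion

section Interpolation

variable [NonUnitalCStarAlgebra A] [PartialOrder A] [StarOrderedRing A]

lemma mul_cfcₙ_eq_of_mul_eq {u c : A} (hc : 0 ≤ c) (h : u * c = c) (f : ℝ → ℝ) :
    u * cfcₙ f c = cfcₙ f c := by
  have hsa := IsSelfAdjoint.of_nonneg hc
  refine her_induction hsa (P := fun z => u * z = z) (isClosed_eq (by fun_prop) (by fun_prop))
    (fun y => ?_) (cfcₙ_mem_her hc hsa (mem_her_self hc) f)
  rw [← mul_assoc, ← mul_assoc, h]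

/-- The predicate that `A` has an abundance of soft elements. -/
def AbundanceSoft (A : Type*) [NonUnitalCStarAlgebra A] [PartialOrder A] [StarOrderedRing A] :
    Prop :=
  ∀ a : A, 0 ≤ a → ∀ ε : ℝ, 0 < ε →
    ∃ b : A, b ∈ her a ∧ 0 ≤ b ∧ IsSoftElem b ∧ Lhd (cutDown a ε) b

/-- If `d` is soft and `x` is a positive element orthogonal to `d` in the closed ideal generated
by `d`, then `x + d` is soft. -/
lemma SoftPos.add_of_mul_eq_zero {x d : A} (hx : 0 ≤ x) (hd : SoftPos d) (hxd : x * d = 0)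
    (h : Lhd x d) : SoftPos (x + d) := by
  obtain ⟨hd0, hd⟩ := hd
  refine ⟨add_nonneg hx hd0, fun δ hδ I hI hp => ?_⟩
  have hint : cfcₙ (softBump δ) (x + d) * d = d * cfcₙ (softBump δ) d :=
    cfcₙ_mul_eq_mul_cfcₙ (.of_nonneg (add_nonneg hx hd0)) (.of_nonneg hd0) _ (by fun_prop)
      (by rw [add_mul, hxd, zero_add])
  have hdp : d * cfcₙ (softBump δ) d ∈ I := hint ▸ I.mul_mem_right _ _ hp
  set p := cfcₙ (softBump δ) d with hpdef
  have hmax : ∀ t : ℝ, 0 < max t δ := fun t => lt_max_of_lt_right hδ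
  set k : ℝ → ℝ := fun t => softBump δ t * (1 - ramp δ t) / max t δ with hk
  have hkc : Continuous k := Continuous.div (by fun_prop) (by fun_prop) fun t => (hmax t).ne'
  have hk0 : k 0 = 0 := by simp [hk]
  have hp3 : p * p * p = d * p * cfcₙ k d := by
    have h1 : p * p = cfcₙ (fun t => softBump δ t * softBump δ t) d :=
      (cfcₙ_mul (softBump δ) (softBump δ) d).symm
    have h2 : d * p = cfcₙ (fun t => t * softBump δ t) d := by
      rw [cfcₙ_mul (fun t => t) (softBump δ) d, cfcₙ_id' ℝ d]
    rw [h1, h2, hpdef, cfcₙ_mul_cfcₙ_of_nonneg hd0 (by fun_prop) (by simp) hkc hk0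
      (fun t _ => rfl)]
    refine cfcₙ_mul_cfcₙ_of_nonneg hd0 (by fun_prop) (by simp) (by fun_prop) (by simp)
      fun t ht => ?_
    rcases le_total t δ with h | h
    · have h2 : t / δ = ramp δ t := (ramp_of_ge hδ h).symm
      simp only [hk, max_eq_right h]
      calc softBump δ t * softBump δ t * softBump δ t
          = softBump δ t * softBump δ t * (ramp δ t - ramp δ t * ramp δ t) := rfl
        _ = t * softBump δ t * (softBump δ t * (1 - ramp δ t) / δ) := by
          rw [← h2]; field_simp
    · simp [softBump_of_le hδ h]
  have hpI : p ∈ I := by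
    refine I.mem_of_mul_mul_self_mem hI
      (cfcₙ_nonneg_of_nonneg hd0 fun t ht => softBump_nonneg hδ ht) ?_
    rw [hp3]
    exact I.mul_mem_right _ _ hdp
  have hdI : d ∈ I := hd δ hδ I hI hpI
  exact I.add_mem (h I hI hdI) hdI

lemma SoftPos.exists_interpolant (hA : AbundanceSoft A) {c : A} (hc : SoftPos c) {δ : ℝ}
    (hδ : 0 < δ) : ∃ c' : A, SoftPos c' ∧ (∃ γ : ℝ, 0 < γ ∧ cfcₙ (ramp γ) c * c' = c') ∧
      ∀ z, cfcₙ (ramp δ) c * z = z → cfcₙ (ramp (δ / 2)) c' * z = z := by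
  obtain ⟨hc0, hc⟩ := hc
  set δ' := δ / 2 with hδ'
  have hδ'0 : 0 < δ' := by positivity
  set p := cfcₙ (softBump δ') c with hp
  have hp0 : 0 ≤ p := cfcₙ_nonneg_of_nonneg hc0 fun t ht => softBump_nonneg hδ'0 ht
  set x := cutDown c δ' with hx
  have hx0 : 0 ≤ x := cutDown_nonneg c δ'
  have hxsa := IsSelfAdjoint.of_nonneg hx0
  obtain ⟨η, hη, hxη⟩ := (hc δ' hδ'0).exists_cutDown hc0 hp0 hδ'0
  have hη2 : 0 < η / 2 := half_pos hη
  set a := cutDown p (η / 2) with ha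
  have ha0 : 0 ≤ a := cutDown_nonneg _ _
  have hasa := IsSelfAdjoint.of_nonneg ha0
  obtain ⟨d, hda, hd0, hds, hd⟩ := hA a ha0 (η / 2) (by positivity)
  rw [ha, cutDown_cutDown hp0 (by positivity) (by positivity), add_halves] at hd
  have hpx : p * x = 0 := by
    rw [hp, hx, cutDown, cfcₙ_mul_cfcₙ_of_nonneg hc0 (h := fun _ => 0) (by fun_prop) (by simp)
        (by fun_prop) (by simp [hδ'0.le]) fun t ht => ?_]
    · exact cfcₙ_zero ..
    · rcases le_total t δ' with h | h
      · rw [max_eq_right (by linarith), mul_zero]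
      · rw [softBump_of_le hδ'0 h, zero_mul]
  have hax : a * x = 0 := by
    have := cfcₙ_mul_eq_smul (r := 0) (.of_nonneg hp0) (fun t => max (t - η / 2) 0)
      (by fun_prop) (by simp [hη2.le]) (y := x) (by rw [hpx, zero_smul])
    rw [ha, cutDown, this]
    simp [hη2.le]
  have hdx : d * x = 0 := by
    refine her_induction hasa (P := fun d => d * x = 0)
      (isClosed_eq (by fun_prop) (by fun_prop)) (fun y => ?_) hda
    rw [mul_assoc, hax, mul_zero]
  have hxd : x * d = 0 := by
    have := congrArg star hdx
    rwa [star_mul, star_zero, hxsa.star_eq, (IsSelfAdjoint.of_nonneg hd0).star_eq] at this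
  refine ⟨x + d, (softPos_of_isSoftElem hd0 hds).add_of_mul_eq_zero hx0 hxd (hxη.trans hd),
    ⟨δ' * min 1 (η / 2), by positivity, ?_⟩, fun z hz => ?_⟩
  · set γ := δ' * min 1 (η / 2) with hγ
    have hγ0 : 0 < γ := by positivity
    have hγδ : γ ≤ δ' := mul_le_of_le_one_right hδ'0.le (min_le_left _ _)
    have hγη : γ ≤ δ' * (η / 2) := by rw [hγ]; gcongr; exact min_le_right _ _
    have h1 : cfcₙ (ramp γ) c * x = x := by
      refine cfcₙ_mul_cfcₙ_of_nonneg hc0 (by fun_prop) (by simp) (by fun_prop)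
        (by simp [hδ'0.le]) fun t ht => ?_
      rcases le_total t δ' with h | h
      · rw [max_eq_right (by linarith), mul_zero]
      · rw [ramp_of_le hγ0 (hγδ.trans h), one_mul]
    have h2 : cfcₙ (ramp γ) c * a = a := by
      have hac : a = cfcₙ (fun t => max (softBump δ' t - η / 2) 0) c :=
        cfcₙ_comp_of_nonneg hc0 (by fun_prop) (by simp) (by fun_prop) (by simp [hη2.le])
          fun t _ => rfl
      rw [hac]
      refine cfcₙ_mul_cfcₙ_of_nonneg hc0 (by fun_prop) (by simp) (by fun_prop)
        (by simp [hη2.le]) fun t ht => ?_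
      rcases le_total (softBump δ' t) (η / 2) with h | h
      · rw [max_eq_right (by linarith), mul_zero]
      · have h3 : η / 2 ≤ t / δ' := by
          have : ramp δ' t ≤ t / δ' := min_le_left _ _
          have := mul_self_nonneg (ramp δ' t)
          rw [softBump] at h
          linarith
        rw [le_div_iff₀ hδ'0] at h3
        rw [ramp_of_le hγ0 (by linarith), one_mul]
    have h3 : cfcₙ (ramp γ) c * d = d := by
      refine her_induction hasa (P := fun d => cfcₙ (ramp γ) c * d = d)
        (isClosed_eq (by fun_prop) (by fun_prop)) (fun y => ?_) hda
      rw [← mul_assoc, ← mul_assoc, h2]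
    rw [mul_add, h1, h3]
  · set H := cfcₙ (ramp δ') x with hH
    have hHsa : IsSelfAdjoint H := cfcₙ_predicate (R := ℝ) _ _
    have hHz : H * z = z := by
      have hcomp : H = cfcₙ (fun u => ramp (1 / 2) (max (u - 1 / 2) 0)) (cfcₙ (ramp δ) c) := by
        have h1 : H = cfcₙ (fun t => ramp δ' (max (t - δ') 0)) c :=
          cfcₙ_comp_of_nonneg hc0 (by fun_prop) (by simp [hδ'0.le]) (by fun_prop) (by simp)
            fun t _ => rfl
        rw [h1]
        refine (cfcₙ_comp_of_nonneg hc0 (by fun_prop) (by simp) (by fun_prop) (by simp)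
          fun t ht => ?_).symm
        rcases le_total t δ with h | h
        · have h2 : max (t / δ - 1 / 2) 0 / (1 / 2) = max (t - δ') 0 / δ' := by
            rw [← max_div_div_right (by norm_num), ← max_div_div_right hδ'0.le, zero_div,
              zero_div, hδ']
            congr 1
            field_simp
          rw [ramp_of_ge hδ h, ramp, ramp, h2]
        · rw [ramp_of_le hδ h, ramp_of_le (by norm_num) (by norm_num), ramp_of_le hδ'0]
          exact le_max_of_le_left (by linarith)
      have := cfcₙ_mul_eq_smul (r := 1) (cfcₙ_predicate (R := ℝ) (ramp δ) c)
        (fun u => ramp (1 / 2) (max (u - 1 / 2) 0)) (by fun_prop) (by simp) (y := z)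
        (by rw [hz, one_smul])
      rw [hcomp, this, ramp_of_le (by norm_num) (by norm_num), one_smul]
    have hHd : H * d = 0 := by
      have := cfcₙ_mul_eq_smul (r := 0) hxsa (ramp δ') (by fun_prop) (by simp) (y := d)
        (by rw [hxd, zero_smul])
      rw [hH, this, ramp_zero, zero_smul]
    have hdH : d * H = 0 := by
      have := congrArg star hHd
      rwa [star_mul, star_zero, hHsa.star_eq, (IsSelfAdjoint.of_nonneg hd0).star_eq] at this
    have hcomm : H * x = x * H := (Commute.cfcₙ_real (Commute.refl x) _).eq
    have hint : cfcₙ (ramp δ') (x + d) * H = H * H :=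
      cfcₙ_mul_eq_mul_cfcₙ (.of_nonneg (add_nonneg hx0 hd0)) hxsa _ (by fun_prop)
        (by rw [add_mul, hdH, add_zero, hcomm])
    calc cfcₙ (ramp δ') (x + d) * z = cfcₙ (ramp δ') (x + d) * H * z := by
          rw [mul_assoc, hHz]
      _ = z := by rw [hint, mul_assoc, hHz, hHz]

/-- There is a soft element `c` on which `x` acts as a unit, such that some continuous function
of `c`, equal to `1` away from zero, acts as a unit on `y`. -/
def SoftPair (x y : A) : Prop :=
  ∃ c : A, SoftPos c ∧ x * c = c ∧ ∃ δ : ℝ, 0 < δ ∧ cfcₙ (ramp δ) c * y = y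

lemma SoftPair.mul_eq {x y : A} (h : SoftPair x y) : x * y = y := by
  obtain ⟨c, hc, hxc, δ, -, hy⟩ := h
  rw [← hy, ← mul_assoc, mul_cfcₙ_eq_of_mul_eq hc.1 hxc]

lemma SoftPair.exists_between (hA : AbundanceSoft A) {x y : A} (h : SoftPair x y) :
    ∃ m : A, 0 ≤ m ∧ ‖m‖ ≤ 1 ∧ Lhd m (m - m * m) ∧ SoftPair x m ∧ SoftPair m y := by
  obtain ⟨c, hc, hxc, δ, hδ, hy⟩ := h
  obtain ⟨c₁, hc₁, ⟨γ₁, hγ₁, hcc₁⟩, h₁⟩ := hc.exists_interpolant hA hδ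
  obtain ⟨c₂, hc₂, ⟨γ₂, hγ₂, hcc₂⟩, h₂⟩ := hc₁.exists_interpolant hA (half_pos hδ)
  refine ⟨cfcₙ (ramp γ₂) c₁, cfcₙ_nonneg_of_nonneg hc₁.1 fun t ht => ramp_nonneg hγ₂ ht,
    norm_cfcₙ_le_of_nonneg hc₁.1 fun t ht => ?_, ?_, ⟨c, hc, hxc, γ₁, hγ₁, ?_⟩,
    ⟨c₂, hc₂, hcc₂, δ / 2 / 2, by positivity, h₂ y (h₁ y hy)⟩⟩
  · rw [abs_of_nonneg (ramp_nonneg hγ₂ ht)]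
    exact ramp_le_one _ _
  · rw [← cfcₙ_softBump_eq]
    exact (lhd_cfcₙ hc₁.1 _).trans (hc₁.2 γ₂ hγ₂)
  · exact mul_cfcₙ_eq_of_mul_eq hc₁.1 hcc₁ _

end Interpolation

section DyadicLimit

section Order

variable [NonUnitalCStarAlgebra A] [PartialOrder A] [StarOrderedRing A]

lemma mul_self_le_of_norm_le_one {m : A} (hm : 0 ≤ m) (hm1 : ‖m‖ ≤ 1) : m * m ≤ m := by
  set s := cfcₙ Real.sqrt m with hs
  have hs0 : 0 ≤ s := cfcₙ_nonneg_of_nonneg hm fun t _ => Real.sqrt_nonneg t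
  have hss : s * s = m := by
    rw [hs, cfcₙ_mul_cfcₙ_of_nonneg hm Real.continuous_sqrt Real.sqrt_zero Real.continuous_sqrt
      Real.sqrt_zero fun t ht => Real.mul_self_sqrt ht]
    exact cfcₙ_id' ℝ m
  have hstar : star s = s := (IsSelfAdjoint.of_nonneg hs0).star_eq
  have h := CStarAlgebra.star_left_conjugate_le_norm_smul (a := s) (b := m)
    (hb := IsSelfAdjoint.of_nonneg hm)
  rw [hstar, hss] at h
  calc m * m = s * m * s := by
        conv_lhs => rw [← hss]
        conv_rhs => rw [← hss]
        simp only [mul_assoc]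
    _ ≤ ‖m‖ • m := h
    _ ≤ (1 : ℝ) • m := smul_le_smul_of_nonneg_right hm1 hm
    _ = m := one_smul _ _

lemma le_of_mul_eq {m y : A} (hm : 0 ≤ m) (hm1 : ‖m‖ ≤ 1) (hy : 0 ≤ y) (hy1 : ‖y‖ ≤ 1)
    (h : m * y = y) : y ≤ m := by
  have hmstar : star m = m := (IsSelfAdjoint.of_nonneg hm).star_eq
  have hystar : star y = y := (IsSelfAdjoint.of_nonneg hy).star_eq
  have h' : y * m = y := by
    have := congrArg star h
    rwa [star_mul, hmstar, hystar] at this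
  have hc := CStarAlgebra.star_left_conjugate_le_norm_smul (a := m) (b := y)
    (hb := IsSelfAdjoint.of_nonneg hy)
  rw [hmstar] at hc
  have hmm : 0 ≤ m * m := by
    have := star_mul_self_nonneg m
    rwa [hmstar] at this
  calc y = m * y * m := by rw [h, h']
    _ ≤ ‖y‖ • (m * m) := hc
    _ ≤ (1 : ℝ) • (m * m) := smul_le_smul_of_nonneg_right hy1 hmm
    _ = m * m := one_smul _ _
    _ ≤ m := mul_self_le_of_norm_le_one hm hm1

end Order

variable [NonUnitalCStarAlgebra A] [PartialOrder A]

variable {P : Type*}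

/-- Iterated averages of a function along the binary tree generated by two maps. -/
noncomputable def dyadicMean (l r : P → P) (f : P → A) : ℕ → P → A
  | 0, q => f q
  | n + 1, q => (1 / 2 : ℝ) • (dyadicMean l r f n (l q) + dyadicMean l r f n (r q))

/-- A binary tree of pairs of positive contractions `(x, y)` with `x * y = y`, where the two
successors of `(x, y)` are `(x, m)` and `(m, y)` for an intermediate contraction `m`. -/
structure InterpolationTree (l r : P → P) (x y : P → A) : Prop where
  fst_left : ∀ q, x (l q) = x q
  snd_right : ∀ q, y (r q) = y q
  snd_left : ∀ q, y (l q) = x (r q)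
  fst_nonneg : ∀ q, 0 ≤ x q
  snd_nonneg : ∀ q, 0 ≤ y q
  norm_fst_le : ∀ q, ‖x q‖ ≤ 1
  norm_snd_le : ∀ q, ‖y q‖ ≤ 1
  mul_eq : ∀ q, x q * y q = y q

namespace InterpolationTree

variable {l r : P → P} {x y : P → A}

lemma dyadicMean_sub (h : InterpolationTree l r x y) (n : ℕ) (q : P) :
    dyadicMean l r x n q - dyadicMean l r y n q = (1 / 2 : ℝ) ^ n • (x q - y q) := by
  induction n generalizing q with
  | zero => simp [dyadicMean]
  | succ n ih =>
    rw [dyadicMean, dyadicMean, ← smul_sub, add_sub_add_comm, ih, ih, h.fst_left, h.snd_right,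
      h.snd_left, ← smul_add, sub_add_sub_cancel, smul_smul, pow_succ']

lemma norm_dyadicMean_le (h : InterpolationTree l r x y) (n : ℕ) (q : P) :
    ‖dyadicMean l r y n q‖ ≤ 1 := by
  induction n generalizing q with
  | zero => exact h.norm_snd_le q
  | succ n ih =>
    rw [dyadicMean, norm_smul, Real.norm_of_nonneg (by norm_num)]
    have := norm_add_le (dyadicMean l r y n (l q)) (dyadicMean l r y n (r q))
    linarith [ih (l q), ih (r q)]

lemma fst_mul_dyadicMean (h : InterpolationTree l r x y) (n : ℕ) (q : P) :
    x q * dyadicMean l r y n q = dyadicMean l r y n q := by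
  induction n generalizing q with
  | zero => exact h.mul_eq q
  | succ n ih =>
    have h1 : x q * dyadicMean l r y n (l q) = dyadicMean l r y n (l q) := by
      have := ih (l q)
      rwa [h.fst_left] at this
    have h2 : x q * dyadicMean l r y n (r q) = dyadicMean l r y n (r q) := by
      rw [← ih (r q), ← mul_assoc, ← h.snd_left, ← h.fst_left, h.mul_eq]
    rw [dyadicMean, mul_smul_comm, mul_add, h1, h2]

lemma dyadicMean_mul_snd (h : InterpolationTree l r x y) (n : ℕ) (q : P) :
    dyadicMean l r x n q * y q = y q := by
  induction n generalizing q with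
  | zero => exact h.mul_eq q
  | succ n ih =>
    have h1 : dyadicMean l r x n (l q) * y q = y q := by
      have h3 : y (l q) * y q = y q := by rw [h.snd_left, ← h.snd_right, h.mul_eq]
      rw [← h3, ← mul_assoc, ih]
    have h2 : dyadicMean l r x n (r q) * y q = y q := by
      rw [← h.snd_right, ih]
    rw [dyadicMean, smul_mul_assoc, add_mul, h1, h2]
    module

variable [StarOrderedRing A]

lemma snd_le_snd_left (h : InterpolationTree l r x y) (q : P) : y q ≤ y (l q) := by
  refine le_of_mul_eq (h.snd_nonneg _) (h.norm_snd_le _) (h.snd_nonneg _) (h.norm_snd_le _) ?_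
  rw [h.snd_left, ← h.snd_right, h.mul_eq]

lemma snd_left_le_fst (h : InterpolationTree l r x y) (q : P) : y (l q) ≤ x q := by
  refine le_of_mul_eq (h.fst_nonneg _) (h.norm_fst_le _) (h.snd_nonneg _) (h.norm_snd_le _) ?_
  rw [← h.fst_left, h.mul_eq]

lemma dyadicMean_succ_sub (h : InterpolationTree l r x y) (n : ℕ) (q : P) :
    0 ≤ dyadicMean l r y (n + 1) q - dyadicMean l r y n q ∧
      dyadicMean l r y (n + 1) q - dyadicMean l r y n q ≤ (1 / 2 : ℝ) ^ n • (x q - y q) := by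
  induction n generalizing q with
  | zero =>
    have h1 : dyadicMean l r y (0 + 1) q - dyadicMean l r y 0 q
        = (1 / 2 : ℝ) • (y (l q) - y q) := by
      simp only [dyadicMean, h.snd_right]
      module
    have h2 : 0 ≤ y (l q) - y q := sub_nonneg.2 (h.snd_le_snd_left q)
    rw [h1]
    refine ⟨smul_nonneg (by norm_num) h2, ?_⟩
    calc (1 / 2 : ℝ) • (y (l q) - y q) ≤ (1 : ℝ) • (y (l q) - y q) :=
          smul_le_smul_of_nonneg_right (by norm_num) h2
      _ ≤ (1 / 2 : ℝ) ^ 0 • (x q - y q) := by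
          rw [one_smul, pow_zero, one_smul]
          exact sub_le_sub_right (h.snd_left_le_fst q) _
  | succ n ih =>
    have h1 : dyadicMean l r y (n + 1 + 1) q - dyadicMean l r y (n + 1) q
        = (1 / 2 : ℝ) • ((dyadicMean l r y (n + 1) (l q) - dyadicMean l r y n (l q))
          + (dyadicMean l r y (n + 1) (r q) - dyadicMean l r y n (r q))) := by
      rw [dyadicMean, dyadicMean.eq_2 l r y q n, ← smul_sub, add_sub_add_comm]
    have h2 : (1 / 2 : ℝ) ^ (n + 1) • (x q - y q) = (1 / 2 : ℝ) •
        ((1 / 2 : ℝ) ^ n • (x (l q) - y (l q)) + (1 / 2 : ℝ) ^ n • (x (r q) - y (r q))) := by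
      rw [h.fst_left, h.snd_right, h.snd_left, ← smul_add, sub_add_sub_cancel, smul_smul,
        pow_succ']
    rw [h1, h2]
    exact ⟨smul_nonneg (by norm_num) (add_nonneg (ih _).1 (ih _).1),
      smul_le_smul_of_nonneg_left (add_le_add (ih _).2 (ih _).2) (by norm_num)⟩

lemma dyadicMean_nonneg (h : InterpolationTree l r x y) (n : ℕ) (q : P) :
    0 ≤ dyadicMean l r y n q := by
  induction n generalizing q with
  | zero => exact h.snd_nonneg q
  | succ n ih => exact smul_nonneg (by norm_num) (add_nonneg (ih _) (ih _))

/-- A solution of the averaging equation along an interpolation tree. -/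
structure IsLimit (l r : P → P) (x y b : P → A) : Prop where
  nonneg : ∀ q, 0 ≤ b q
  norm_le : ∀ q, ‖b q‖ ≤ 1
  fst_mul : ∀ q, x q * b q = b q
  mul_snd : ∀ q, b q * y q = y q
  eq_mean : ∀ q, b q = (1 / 2 : ℝ) • (b (l q) + b (r q))

lemma exists_isLimit (h : InterpolationTree l r x y) : ∃ b : P → A, IsLimit l r x y b := by
  have hcauchy : ∀ q, CauchySeq fun n => dyadicMean l r y n q := fun q => by
    refine cauchySeq_of_le_geometric (1 / 2) ‖x q - y q‖ (by norm_num) fun n => ?_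
    obtain ⟨h1, h2⟩ := h.dyadicMean_succ_sub n q
    rw [dist_comm, dist_eq_norm]
    refine (CStarAlgebra.norm_le_norm_of_nonneg_of_le h1 h2).trans ?_
    rw [norm_smul, Real.norm_of_nonneg (by positivity), mul_comm]
  choose b hb using fun q => cauchySeq_tendsto_of_complete (hcauchy q)
  have hb' : ∀ q, Tendsto (fun n => dyadicMean l r x n q) atTop (𝓝 (b q)) := fun q => by
    have h1 : Tendsto (fun n : ℕ => (1 / 2 : ℝ) ^ n • (x q - y q)) atTop (𝓝 0) := by
      have := (tendsto_pow_atTop_nhds_zero_of_lt_one (r := (1 / 2 : ℝ)) (by norm_num)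
        (by norm_num)).smul_const (x q - y q)
      rwa [zero_smul] at this
    have h2 := (hb q).add h1
    rw [add_zero] at h2
    refine h2.congr fun n => ?_
    rw [← h.dyadicMean_sub, add_sub_cancel]
  refine ⟨b, ⟨fun q => ?_, fun q => ?_, fun q => ?_, fun q => ?_, fun q => ?_⟩⟩
  · exact ge_of_tendsto' (hb q) fun n => h.dyadicMean_nonneg n q
  · exact le_of_tendsto' (hb q).norm fun n => h.norm_dyadicMean_le n q
  · exact tendsto_nhds_unique (((hb q).const_mul _).congr fun n => h.fst_mul_dyadicMean n q)
      (hb q)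
  · exact tendsto_nhds_unique (((hb' q).mul_const _).congr fun n => h.dyadicMean_mul_snd n q)
      tendsto_const_nhds
  · exact tendsto_nhds_unique ((tendsto_add_atTop_iff_nat 1).2 (hb q))
      (((hb (l q)).add (hb (r q))).const_smul _)

/-- The spectral behaviour of a limit element `b` at the value `ρ`: the element `e - e * e`
is an eigenvector of `b` for `ρ`, and it generates an ideal that is `ρ`-close to `b`. -/
def IsCutAt (x y b : A) (ρ : ℝ) : Prop :=
  ∃ e : A, 0 ≤ e ∧ Lhd e (e - e * e) ∧ x * e = e ∧ e * y = y ∧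
    b * (e - e * e) = ρ • (e - e * e) ∧ ∃ v : A, Lhd v e ∧ ‖b - v‖ ≤ ρ

variable {b : P → A}

lemma IsLimit.right_mul_fst (h : InterpolationTree l r x y) (hb : IsLimit l r x y b) (q : P) :
    b q * x q = b q := by
  have := congrArg star (hb.fst_mul q)
  rwa [star_mul, (IsSelfAdjoint.of_nonneg (hb.nonneg q)).star_eq,
    (IsSelfAdjoint.of_nonneg (h.fst_nonneg q)).star_eq] at this

lemma IsLimit.isCutAt_half (h : InterpolationTree l r x y) (hb : IsLimit l r x y b) (q : P)
    (hm : Lhd (y (l q)) (y (l q) - y (l q) * y (l q))) : IsCutAt (x q) (y q) (b q) (1 / 2) := by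
  have hl : b (l q) * y (l q) = y (l q) := hb.mul_snd _
  have hr : b (r q) * y (l q) = b (r q) := by rw [h.snd_left, hb.right_mul_fst h]
  refine ⟨y (l q), h.snd_nonneg _, hm, ?_, ?_, ?_, (1 / 2 : ℝ) • b (r q), ?_, ?_⟩
  · rw [← h.fst_left, h.mul_eq]
  · rw [h.snd_left, ← h.snd_right, h.mul_eq]
  · rw [hb.eq_mean q, smul_mul_assoc]
    congr 1
    rw [add_mul, mul_sub, mul_sub, ← mul_assoc, ← mul_assoc, hl, hr, hr, sub_self, add_zero]
  · refine Lhd.real_smul (fun I _ hI => ?_) _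
    rw [← hr]
    exact I.mul_mem_left _ _ hI
  · rw [hb.eq_mean q, smul_add, add_sub_cancel_right, norm_smul,
      Real.norm_of_nonneg (by norm_num)]
    linarith [hb.norm_le (l q)]

lemma IsLimit.isCutAt_left (h : InterpolationTree l r x y) (hb : IsLimit l r x y b) {q : P}
    {ρ : ℝ} (hρ : IsCutAt (x (l q)) (y (l q)) (b (l q)) ρ) :
    IsCutAt (x q) (y q) (b q) (ρ / 2) := by
  obtain ⟨e, he0, hee, hxe, hey, hbe, v, hve, hv⟩ := hρ
  have hye : y (l q) * e = y (l q) := by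
    have := congrArg star hey
    rwa [star_mul, (IsSelfAdjoint.of_nonneg he0).star_eq,
      (IsSelfAdjoint.of_nonneg (h.snd_nonneg _)).star_eq] at this
  have hr : b (r q) * e = b (r q) := by
    rw [← hb.right_mul_fst h (r q), ← h.snd_left, mul_assoc, hye]
  refine ⟨e, he0, hee, by rwa [h.fst_left] at hxe, ?_, ?_, (1 / 2 : ℝ) • (v + b (r q)), ?_, ?_⟩
  · have h3 : y (l q) * y q = y q := by rw [h.snd_left, ← h.snd_right, h.mul_eq]
    rw [← h3, ← mul_assoc, hey]
  · rw [hb.eq_mean q, smul_mul_assoc, add_mul, hbe, mul_sub (b (r q)), ← mul_assoc, hr, hr,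
      sub_self, add_zero, smul_smul]
    congr 1
    ring
  · refine Lhd.real_smul (fun I hI he => I.add_mem (hve I hI he) ?_) _
    rw [← hr]
    exact I.mul_mem_left _ _ he
  · rw [hb.eq_mean q, ← smul_sub, add_sub_add_right_eq_sub, norm_smul,
      Real.norm_of_nonneg (by norm_num)]
    linarith

lemma IsLimit.isCutAt_right (h : InterpolationTree l r x y) (hb : IsLimit l r x y b) {q : P}
    {ρ : ℝ} (hρ : IsCutAt (x (r q)) (y (r q)) (b (r q)) ρ) :
    IsCutAt (x q) (y q) (b q) ((1 + ρ) / 2) := by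
  obtain ⟨e, he0, hee, hxe, hey, hbe, v, hve, hv⟩ := hρ
  rw [← h.snd_left] at hxe
  have hl : b (l q) * e = e := by rw [← hxe, ← mul_assoc, hb.mul_snd]
  refine ⟨e, he0, hee, ?_, by rwa [h.snd_right] at hey, ?_, (1 / 2 : ℝ) • v, hve.real_smul _, ?_⟩
  · rw [← hxe, ← mul_assoc, ← h.fst_left, h.mul_eq]
  · rw [hb.eq_mean q, smul_mul_assoc, add_mul, hbe, mul_sub (b (l q)), ← mul_assoc, hl]
    module
  · have : b q - (1 / 2 : ℝ) • v = (1 / 2 : ℝ) • (b (l q) + (b (r q) - v)) := by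
      rw [hb.eq_mean q]; module
    rw [this, norm_smul, Real.norm_of_nonneg (by norm_num)]
    linarith [norm_add_le (b (l q)) (b (r q) - v), hb.norm_le (l q)]

lemma IsLimit.isCutAt_dyadic (h : InterpolationTree l r x y) (hb : IsLimit l r x y b)
    (hm : ∀ q, Lhd (y (l q)) (y (l q) - y (l q) * y (l q))) (n k : ℕ) (hk : 0 < k)
    (hkn : k < 2 ^ n) (q : P) : IsCutAt (x q) (y q) (b q) (k / 2 ^ n) := by
  induction n generalizing k q with
  | zero => simp at hkn; omega
  | succ n ih =>
    have h2 : (2 : ℝ) ^ n ≠ 0 := by positivity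
    rcases lt_trichotomy k (2 ^ n) with hlt | heq | hgt
    · convert hb.isCutAt_left h (ih k hk hlt (l q)) using 1
      rw [pow_succ]; field_simp
    · convert hb.isCutAt_half h q (hm q) using 1
      rw [heq, pow_succ]; push_cast; field_simp
    · convert hb.isCutAt_right h (ih (k - 2 ^ n) (by omega) (by rw [pow_succ] at hkn; omega)
        (r q)) using 1
      rw [Nat.cast_sub hgt.le, pow_succ]; push_cast; field_simp; ring

lemma IsLimit.exists_isCutAt (h : InterpolationTree l r x y) (hb : IsLimit l r x y b)
    (hm : ∀ q, Lhd (y (l q)) (y (l q) - y (l q) * y (l q))) (q : P) {s t : ℝ} (hs : 0 ≤ s)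
    (hst : s < t) (ht : t ≤ 1) : ∃ ρ : ℝ, s < ρ ∧ ρ < t ∧ IsCutAt (x q) (y q) (b q) ρ := by
  obtain ⟨n, hn⟩ := pow_unbounded_of_one_lt (1 / (t - s)) (one_lt_two (α := ℝ))
  have h2 : (0 : ℝ) < 2 ^ n := by positivity
  rw [div_lt_iff₀ (by linarith)] at hn
  set k := ⌊s * 2 ^ n⌋₊ + 1 with hk
  have hk1 : s * 2 ^ n < k := by rw [hk]; push_cast; exact Nat.lt_floor_add_one _
  have hk2 : (k : ℝ) < t * 2 ^ n := by
    have := Nat.floor_le (a := s * 2 ^ n) (by positivity)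
    rw [hk]; push_cast; linarith
  refine ⟨k / 2 ^ n, (lt_div_iff₀ h2).2 hk1, (div_lt_iff₀ h2).2 hk2,
    hb.isCutAt_dyadic h hm n k (by omega) ?_ q⟩
  have : (k : ℝ) < 2 ^ n := hk2.trans_le (mul_le_of_le_one_left h2.le ht)
  exact_mod_cast this

end InterpolationTree

end DyadicLimit

section CompletelySoft

variable [NonUnitalCStarAlgebra A] [PartialOrder A] [StarOrderedRing A]

lemma SoftPair.exists_interpolationTree (hA : AbundanceSoft A) {x y : A} (h : SoftPair x y)
    (hx : 0 ≤ x) (hx1 : ‖x‖ ≤ 1) (hy : 0 ≤ y) (hy1 : ‖y‖ ≤ 1) :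
    ∃ (P : Set (A × A)) (l r : P → P) (X Y : P → A), InterpolationTree l r X Y ∧
      (∀ q, Lhd (Y (l q)) (Y (l q) - Y (l q) * Y (l q))) ∧ ∃ q, X q = x ∧ Y q = y := by
  let P : Set (A × A) :=
    {q | SoftPair q.1 q.2 ∧ (0 ≤ q.1 ∧ ‖q.1‖ ≤ 1) ∧ 0 ≤ q.2 ∧ ‖q.2‖ ≤ 1}
  choose m hm0 hm1 hmm hxm hmy using fun q : P => q.2.1.exists_between hA
  refine ⟨P, fun q => ⟨(q.1.1, m q), hxm q, q.2.2.1, hm0 q, hm1 q⟩,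
    fun q => ⟨(m q, q.1.2), hmy q, ⟨hm0 q, hm1 q⟩, q.2.2.2⟩, fun q => q.1.1, fun q => q.1.2,
    ⟨fun _ => rfl, fun _ => rfl, fun _ => rfl, fun q => q.2.2.1.1, fun q => q.2.2.2.1,
      fun q => q.2.2.1.2, fun q => q.2.2.2.2, fun q => q.2.1.mul_eq⟩, hmm,
    ⟨(x, y), h, ⟨hx, hx1⟩, hy, hy1⟩, rfl, rfl⟩

/-- If the spectral behaviour of a positive contraction is controlled on a dense set of values,
then all its cut-downs are soft. -/
lemma softPos_cutDown_of_isCutAt {x y b : A} (hb0 : 0 ≤ b) (hb1 : ‖b‖ ≤ 1)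
    (hb : ∀ s t : ℝ, 0 ≤ s → s < t → t ≤ 1 →
      ∃ ρ : ℝ, s < ρ ∧ ρ < t ∧ InterpolationTree.IsCutAt x y b ρ)
    {t : ℝ} (ht : 0 ≤ t) : SoftPos (cutDown b t) := by
  refine ⟨cutDown_nonneg b t, fun δ hδ I hI hp => ?_⟩
  have key : ∀ t' : ℝ, t < t' → cutDown b t' ∈ I := by
    intro t' htt'
    rcases lt_or_ge t 1 with h1 | h1
    · obtain ⟨ρ, hρ, hρ', e, he0, hee, -, -, hbe, v, hve, hv⟩ :=
        hb t (min (min t' (t + δ)) 1) ht (lt_min (lt_min htt' (by linarith)) h1)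
          (min_le_right _ _)
      obtain ⟨⟨hρ1, hρ2⟩, -⟩ : (ρ < t' ∧ ρ < t + δ) ∧ ρ < 1 := by
        simpa only [lt_min_iff] using hρ'
      have hF : cfcₙ (softBump δ) (cutDown b t) = cfcₙ (fun u => softBump δ (max (u - t) 0)) b :=
        cfcₙ_comp_of_nonneg hb0 (by fun_prop) (by simp [ht]) (by fun_prop) (by simp)
          fun u _ => rfl
      have hpos : 0 < softBump δ (max (ρ - t) 0) := by
        rw [max_eq_left (by linarith)]
        exact softBump_pos (by linarith) (by linarith)
      have hmul := cfcₙ_mul_eq_smul (.of_nonneg hb0) (fun u => softBump δ (max (u - t) 0))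
        (by fun_prop) (by simp [ht]) hbe
      have hpI : e - e * e ∈ I := by
        have h2 := I.real_smul_mem hI (softBump δ (max (ρ - t) 0))⁻¹
          (I.mul_mem_right _ (e - e * e) hp)
        rwa [hF, hmul, inv_smul_smul₀ hpos.ne'] at h2
      exact I.cutDown_mem_of_norm_sub_le hI hb0 (hve I hI (hee I hI hpI)) (ht.trans hρ.le) hρ1 hv
    · exact I.cutDown_mem_of_norm_sub_le hI hb0 I.zero_mem zero_le_one (h1.trans_lt htt')
        (by rwa [sub_zero])
  have hmem : cutDown b t ∈ closure (I : Set A) := by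
    rw [Metric.mem_closure_iff]
    intro ε hε
    refine ⟨cutDown b (t + ε / 2), key _ (by linarith), ?_⟩
    rw [← cutDown_cutDown hb0 ht (by positivity), dist_eq_norm]
    exact (norm_sub_cutDown_le (cutDown_nonneg b t) (by positivity)).trans_lt (by linarith)
  rwa [hI.closure_eq] at hmem

lemma AbundanceSoft.exists_completelySoftElem (hA : AbundanceSoft A) {a : A} (ha : 0 ≤ a)
    {ε : ℝ} (hε : 0 < ε) :
    ∃ b : A, b ∈ her a ∧ 0 ≤ b ∧ CompletelySoftElem b ∧ Lhd (cutDown a ε) b := by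
  have hasa := IsSelfAdjoint.of_nonneg ha
  obtain ⟨c₀, hc₀a, hc₀, hc₀s, hac₀⟩ := hA a ha (ε / 2) (half_pos hε)
  have hsoft := softPos_of_isSoftElem hc₀ hc₀s
  obtain ⟨δ, hδ, hw⟩ := hac₀.exists_cutDown (cutDown_nonneg _ _) hc₀ (half_pos hε)
  rw [cutDown_cutDown ha (by positivity) (by positivity), add_halves] at hw
  obtain ⟨c₁, hc₁, ⟨γ, hγ, hcc₁⟩, h₁⟩ := hsoft.exists_interpolant hA hδ
  set w := cutDown c₀ δ with hwdef
  have hw0 : 0 ≤ w := cutDown_nonneg _ _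
  set x := cfcₙ (ramp γ) c₀ with hx
  have hx0 : 0 ≤ x := cfcₙ_nonneg_of_nonneg hc₀ fun t ht => ramp_nonneg hγ ht
  have hx1 : ‖x‖ ≤ 1 := norm_cfcₙ_le_of_nonneg hc₀ fun t ht => by
    rw [abs_of_nonneg (ramp_nonneg hγ ht)]
    exact ramp_le_one _ _
  set s : ℝ := 1 / (1 + ‖w‖) with hs
  have hs0 : 0 < s := by positivity
  have hew : cfcₙ (ramp δ) c₀ * w = w := by
    refine cfcₙ_mul_cfcₙ_of_nonneg hc₀ (by fun_prop) (by simp) (by fun_prop)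
      (by simp [hδ.le]) fun t ht => ?_
    rcases le_total t δ with h | h
    · rw [max_eq_right (by linarith), mul_zero]
    · rw [ramp_of_le hδ h, one_mul]
  have hpair : SoftPair x (s • w) :=
    ⟨c₁, hc₁, hcc₁, δ / 2, half_pos hδ, h₁ _ (by rw [mul_smul_comm, hew])⟩
  have hy1 : ‖s • w‖ ≤ 1 := by
    rw [norm_smul, Real.norm_of_nonneg hs0.le, hs, one_div, inv_mul_eq_div,
      div_le_one (by positivity)]
    linarith
  obtain ⟨P, l, r, X, Y, htree, hm, q, hXq, hYq⟩ :=
    hpair.exists_interpolationTree hA hx0 hx1 (smul_nonneg hs0.le hw0) hy1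
  obtain ⟨B, hB⟩ := htree.exists_isLimit
  refine ⟨B q, ?_, hB.nonneg q, fun t ht => ?_, hw.trans fun I hI hbI => ?_⟩
  · have hxa : X q ∈ her a := hXq ▸ cfcₙ_mem_her ha (.of_nonneg hc₀) hc₀a _
    have := mul_mul_mem_her_of_mem hasa hxa hxa (B q)
    rwa [hB.fst_mul, hB.right_mul_fst htree] at this
  · exact (softPos_cutDown_of_isCutAt (hB.nonneg q) (hB.norm_le q)
      (fun s t hs hst ht => hB.exists_isCutAt htree hm q hs hst ht) ht).isSoftElem
  · have h2 : s • w ∈ I := by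
      rw [← hYq, ← hB.mul_snd q]
      exact I.mul_mem_right _ _ hbI
    have h3 := I.real_smul_mem hI s⁻¹ h2
    rwa [inv_smul_smul₀ hs0.ne'] at h3

end CompletelySoft

/-- A C*-algebra has an abundance of soft elements iff it has an
abundance of completely soft elements. -/
theorem abundance_soft_iff_abundance_completelySoft [NonUnitalCStarAlgebra A]
    [PartialOrder A] [StarOrderedRing A] :
    (∀ a : A, 0 ≤ a → ∀ ε : ℝ, 0 < ε →
        ∃ b : A, b ∈ her a ∧ 0 ≤ b ∧ IsSoftElem b ∧ Lhd (cutDown a ε) b)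
      ↔ (∀ a : A, 0 ≤ a → ∀ ε : ℝ, 0 < ε →
        ∃ b : A, b ∈ her a ∧ 0 ≤ b ∧ CompletelySoftElem b ∧ Lhd (cutDown a ε) b) := by
  refine ⟨fun hA a ha ε hε => AbundanceSoft.exists_completelySoftElem hA ha hε,
    fun hA a ha ε hε => ?_⟩
  obtain ⟨b, hba, hb, hbs, hab⟩ := hA a ha ε hε
  refine ⟨b, hba, hb, ?_, hab⟩
  have := hbs 0 le_rfl
  rwa [cutDown_zero hb] at this
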